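/- There is no Gallai 4-coloring of K_7 with color distribution (9, 4, 4, 4). -/

import Mathlib

/-- An edge coloring of `K_n` (edges = non-diagonal elements of `Sym2 (Fin n)`)
is a Gallai coloring if no triangle receives three pairwise distinct colors. -/
def IsGallai {n : ℕ} {C : Type*} (c : Sym2 (Fin n) → C) : Prop :=
  ∀ a b d : Fin n, a ≠ b → b ≠ d → a ≠ d →
    c s(a, b) = c s(b, d) ∨ c s(b, d) = c s(a, d) ∨ c s(a, b) = c s(a, d)

/-- The number of edges of `K_n` receiving color `i`. -/
def colorCard {n : ℕ} {C : Type*} [DecidableEq C] (c : Sym2 (Fin n) → C) (i : C) : ℕ :=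
  (Finset.univ.filter (fun e : Sym2 (Fin n) => ¬ e.IsDiag ∧ c e = i)).card

/-- The graph of edges whose color lies in `T`. -/
def colG {V : Type*} (f : Sym2 V → Fin 4) (T : Finset (Fin 4)) : SimpleGraph V where
  Adj u v := u ≠ v ∧ f s(u, v) ∈ T
  symm := ⟨fun u v h => ⟨h.1.symm, by rw [Sym2.eq_swap]; exact h.2⟩⟩
  loopless := ⟨fun _ h => h.1 rfl⟩

/-- The Gallai property on an arbitrary vertex type. -/
def Gal {V : Type*} (f : Sym2 V → Fin 4) : Prop :=
  ∀ a b d : V, a ≠ b → b ≠ d → a ≠ d →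
    f s(a, b) = f s(b, d) ∨ f s(b, d) = f s(a, d) ∨ f s(a, b) = f s(a, d)

/-- If `A ∪ B` is connected then one of `A`, `B` is. -/
lemma colG_key {V : Type*} {f : Sym2 V → Fin 4} (hf : Gal f) {A B : Finset (Fin 4)}
    (h : (colG f (A ∪ B)).Connected) (hA : ¬ (colG f A).Connected) :
    (colG f B).Connected := by
  classical
  have hne := h.nonempty
  -- step: every edge of A ∪ B is joined in B
  have step : ∀ u v, (colG f (A ∪ B)).Adj u v → (colG f B).Reachable u v := by
    intro u v huv
    rcases Finset.mem_union.1 huv.2 with h1 | h1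
    swap
    · exact SimpleGraph.Adj.reachable (⟨huv.1, h1⟩ : (colG f B).Adj u v)
    -- an edge leaving the A-component of u
    have hex : ∃ k w, (colG f A).Reachable u k ∧ ¬ (colG f A).Reachable u w ∧
        (colG f (A ∪ B)).Adj k w := by
      by_contra hno
      push Not at hno
      apply hA
      have hall : ∀ w, (colG f A).Reachable u w := by
        intro w
        obtain ⟨p⟩ := h.preconnected u w
        have : ∀ x y, (colG f (A ∪ B)).Walk x y → (colG f A).Reachable u x →
            (colG f A).Reachable u y := by
          intro x y p
          induction p with
          | nil => exact id
          | cons hxy _ ih =>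
            intro hx
            apply ih
            by_contra hc
            exact hno _ _ hx hc hxy
        exact this u w p (SimpleGraph.Reachable.refl _)
      exact ⟨fun x y => (hall x).symm.trans (hall y)⟩
    obtain ⟨k, w, hk, hw, hkw⟩ := hex
    have notA : ∀ x, (colG f A).Reachable u x → x ≠ w ∧ f s(x, w) ∉ A := by
      intro x hx
      have hxw : x ≠ w := by rintro rfl; exact hw hx
      refine ⟨hxw, fun hm => hw (hx.trans ?_)⟩
      exact SimpleGraph.Adj.reachable (⟨hxw, hm⟩ : (colG f A).Adj x w)
    have spread : ∀ x y, (colG f A).Walk x y → (colG f A).Reachable u x →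
        f s(x, w) ∈ B → f s(y, w) ∈ B := by
      intro x y p
      induction p with
      | nil => exact fun _ => id
      | @cons x y z hxy _ ih =>
        intro hx hB
        have hy : (colG f A).Reachable u y := hx.trans hxy.reachable
        apply ih hy
        have hxA := hxy.2
        have nx := notA x hx
        have ny := notA y hy
        rcases hf x y w hxy.1 ny.1 nx.1 with e | e | e
        · rw [e] at hxA; exact absurd hxA ny.2
        · rw [e]; exact hB
        · rw [e] at hxA; exact absurd hxA nx.2
    have hkB : f s(k, w) ∈ B :=
      (Finset.mem_union.1 hkw.2).resolve_left (notA k hk).2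
    have all : ∀ x, (colG f A).Reachable u x → (colG f B).Reachable x w := by
      intro x hx
      obtain ⟨p⟩ := hk.symm.trans hx
      exact SimpleGraph.Adj.reachable
        (⟨(notA x hx).1, spread k x p hk hkB⟩ : (colG f B).Adj x w)
    have hv : (colG f A).Reachable u v :=
      SimpleGraph.Adj.reachable (⟨huv.1, h1⟩ : (colG f A).Adj u v)
    exact (all u (SimpleGraph.Reachable.refl _)).trans (all v hv).symm
  refine ⟨fun x y => ?_⟩
  obtain ⟨p⟩ := h.preconnected x y
  induction p with
  | nil => exact SimpleGraph.Reachable.refl _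
  | cons hxy _ ih => exact (step _ _ hxy).trans ih

/-- A connected color class has at least `|V| - 1` edges. -/
lemma colG_count {V : Type*} [Fintype V] [DecidableEq V] {f : Sym2 V → Fin 4} {i : Fin 4}
    (h : (colG f {i}).Connected) :
    Fintype.card V ≤
      (Finset.univ.filter (fun e : Sym2 V => ¬ e.IsDiag ∧ f e = i)).card + 1 := by
  have h1 := h.card_vert_le_card_edgeSet_add_one
  have h2 : (colG f {i}).edgeSet =
      ((Finset.univ.filter (fun e : Sym2 V => ¬ e.IsDiag ∧ f e = i) : Finset (Sym2 V)) :
        Set (Sym2 V)) := by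
    ext e
    induction e with
    | _ x y => simp [colG]
  rw [h2, Nat.card_eq_fintype_card] at h1
  simpa using h1

/-- If no color among 1, 2, 3 is connected, neither is their union. -/
lemma colG_three {V : Type*} {f : Sym2 V → Fin 4} (hf : Gal f)
    (h1 : ¬ (colG f {1}).Connected) (h2 : ¬ (colG f {2}).Connected)
    (h3 : ¬ (colG f {3}).Connected) : ¬ (colG f ({1} ∪ ({2} ∪ {3}))).Connected := by
  intro h
  exact h3 (colG_key hf (colG_key hf h h1) h2)

/-- A vertex all of whose edges have color 0 is impossible. -/
lemma no_dominating (c : Sym2 (Fin 7) → Fin 4) (hc : IsGallai c)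
    (h0 : colorCard c 0 = 9) (h1 : colorCard c 1 = 4) (h2 : colorCard c 2 = 4)
    (h3 : colorCard c 3 = 4) (v : Fin 7) (hv : ∀ x, x ≠ v → c s(v, x) = 0) : False := by
  classical
  let W := {x : Fin 7 // x ≠ v}
  let g : Sym2 W → Fin 4 := fun e => c (e.map Subtype.val)
  have hW : Fintype.card W = 6 := by simp [W]
  have hg : Gal g := by
    intro a b d hab hbd had
    exact hc a b d (fun h => hab (Subtype.ext h)) (fun h => hbd (Subtype.ext h))
      (fun h => had (Subtype.ext h))
  have hinj : Function.Injective (Sym2.map (Subtype.val : W → Fin 7)) :=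
    Sym2.map.injective Subtype.val_injective
  let E : Fin 4 → Finset (Sym2 W) := fun i =>
    Finset.univ.filter (fun e : Sym2 W => ¬ e.IsDiag ∧ g e = i)
  have hsub : ∀ i, (E i).image (Sym2.map Subtype.val) ⊆
      Finset.univ.filter (fun e : Sym2 (Fin 7) => ¬ e.IsDiag ∧ c e = i) := by
    intro i e he
    obtain ⟨e', he', rfl⟩ := Finset.mem_image.1 he
    simp only [E, Finset.mem_filter, Finset.mem_univ, true_and] at he' ⊢
    refine ⟨?_, he'.2⟩
    have := he'.1
    induction e' with
    | _ x y =>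
      intro hd
      exact this (Sym2.mk_isDiag_iff.2 (Subtype.ext (Sym2.mk_isDiag_iff.1 hd)))
  have hle : ∀ i, (E i).card ≤ colorCard c i := by
    intro i
    rw [← Finset.card_image_of_injective (E i) hinj]
    exact Finset.card_le_card (hsub i)
  have hno : ∀ i, (E i).card ≤ 4 → ¬ (colG g {i}).Connected := by
    intro i hi h
    have := colG_count h
    rw [hW] at this
    change 6 ≤ (E i).card + 1 at this
    omega
  have hE0 : (E 0).card + 6 ≤ 9 := by
    let St : Finset (Sym2 (Fin 7)) := (Finset.univ.erase v).image (fun x => s(v, x))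
    have hSt : St.card = 6 := by
      rw [Finset.card_image_of_injective]
      · simp
      · intro x y h
        exact Sym2.congr_right.1 h
    rw [← h0, ← hSt, ← Finset.card_image_of_injective (E 0) hinj, ← Finset.card_union_of_disjoint]
    · apply Finset.card_le_card
      apply Finset.union_subset (hsub 0)
      intro e he
      obtain ⟨x, hx, rfl⟩ := Finset.mem_image.1 he
      have hxv := Finset.ne_of_mem_erase hx
      simp [hv x hxv, hxv.symm]
    · rw [Finset.disjoint_left]
      intro e he he'
      obtain ⟨e', -, rfl⟩ := Finset.mem_image.1 he
      obtain ⟨x, -, hx⟩ := Finset.mem_image.1 he'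
      have hm : v ∈ Sym2.map (Subtype.val : W → Fin 7) e' := by
        rw [← hx]; exact Sym2.mem_mk_left _ _
      obtain ⟨a, -, ha⟩ := Sym2.mem_map.1 hm
      exact a.2 ha
  have htop : (colG g ({0} ∪ ({1} ∪ ({2} ∪ {3})))).Connected := by
    have : Nonempty W := Fintype.card_pos_iff.1 (by omega)
    refine ⟨fun x y => ?_⟩
    by_cases hxy : x = y
    · rw [hxy]
    · refine SimpleGraph.Adj.reachable (?_ : (colG g _).Adj x y)
      refine ⟨hxy, ?_⟩
      generalize g s(x, y) = i
      revert i
      decide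
  have := colG_key hg htop (hno 0 (by omega))
  exact colG_three hg (hno 1 (by have := hle 1; omega)) (hno 2 (by have := hle 2; omega))
    (hno 3 (by have := hle 3; omega)) this

/-- There is no Gallai 4-coloring of `K_7` with color distribution `(9, 4, 4, 4)`. -/
theorem no_gallai_K7_9444 :
    ¬ ∃ c : Sym2 (Fin 7) → Fin 4, IsGallai c ∧
      colorCard c 0 = 9 ∧ colorCard c 1 = 4 ∧ colorCard c 2 = 4 ∧ colorCard c 3 = 4 := by
  classical
  rintro ⟨c, hc, h0, h1, h2, h3⟩
  have hno : ∀ i, colorCard c i = 4 → ¬ (colG c {i}).Connected := by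
    intro i hi h
    have := colG_count h
    change Fintype.card (Fin 7) ≤ colorCard c i + 1 at this
    simp at this
    omega
  have hN := colG_three hc (hno 1 h1) (hno 2 h2) (hno 3 h3)
  set G := colG c ({1} ∪ ({2} ∪ {3})) with hG
  have hxy : ∃ x y, ¬ G.Reachable x y := by
    by_contra h
    push Not at h
    exact hN ⟨h⟩
  obtain ⟨x, y, hxy⟩ := hxy
  let S : Finset (Fin 7) := Finset.univ.filter (fun z => G.Reachable x z)
  have hS : ∀ z, z ∈ S ↔ G.Reachable x z := by simp [S]
  have hcross : ∀ a ∈ S, ∀ b ∈ Sᶜ, c s(a, b) = 0 := by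
    intro a ha b hb
    rw [Finset.mem_compl, hS] at hb
    rw [hS] at ha
    by_contra hne
    apply hb
    refine ha.trans (SimpleGraph.Adj.reachable (?_ : (colG c _).Adj a b))
    refine ⟨by rintro rfl; exact hb ha, ?_⟩
    revert hne
    generalize c s(a, b) = i
    revert i
    decide
  have hprod : S.card * Sᶜ.card ≤ 9 := by
    rw [← Finset.card_product, ← h0, ← Finset.card_image_of_injOn (f := fun p => s(p.1, p.2))]
    · apply Finset.card_le_card
      intro e he
      obtain ⟨⟨a, b⟩, hab, rfl⟩ := Finset.mem_image.1 he
      obtain ⟨ha, hb⟩ := Finset.mem_product.1 hab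
      have : a ≠ b := by rintro rfl; exact (Finset.mem_compl.1 hb) ha
      simp [hcross a ha b hb, this]
    · rintro ⟨a, b⟩ hab ⟨a', b'⟩ hab' h
      simp only [Finset.coe_product, Set.mem_prod, Finset.mem_coe, Finset.mem_compl] at hab hab'
      rcases Sym2.eq_iff.1 h with ⟨e1, e2⟩ | ⟨e1, e2⟩
      · exact Prod.ext e1 e2
      · dsimp only at e1 e2
        subst e1
        exact absurd hab.1 hab'.2
  have hsum : S.card + Sᶜ.card = 7 := by simpa using Finset.card_add_card_compl S
  have hp1 : 0 < S.card := Finset.card_pos.2 ⟨x, (hS x).2 (SimpleGraph.Reachable.refl _)⟩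
  have hp2 : 0 < Sᶜ.card :=
    Finset.card_pos.2 ⟨y, Finset.mem_compl.2 (fun h => hxy ((hS y).1 h))⟩
  have hcase : S.card = 1 ∨ Sᶜ.card = 1 := by
    generalize S.card = p at *
    generalize Sᶜ.card = q at *
    obtain rfl : q = 7 - p := by omega
    have : p ≤ 6 := by omega
    interval_cases p <;> simp_all
  rcases hcase with h | h
  · obtain ⟨v, hv⟩ := Finset.card_eq_one.1 h
    refine no_dominating c hc h0 h1 h2 h3 v (fun z hz => hcross v (by simp [hv]) z ?_)
    simp [hv, hz]
  · obtain ⟨v, hv⟩ := Finset.card_eq_one.1 h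
    refine no_dominating c hc h0 h1 h2 h3 v (fun z hz => ?_)
    rw [Sym2.eq_swap]
    refine hcross z ?_ v (by simp [hv])
    by_contra hzS
    have : z ∈ Sᶜ := Finset.mem_compl.2 hzS
    rw [hv] at this
    exact hz (Finset.mem_singleton.1 this)
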